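/- Let λ = (λ₁, λ₂) with 0 < λ₁ < λ₂ and let 𝔤_λ be the associated 6-dimensional oscillator Lie algebra. Then: (1) a bivector r ∈ ⋀²𝔤_λ is a solution of the generalized classical Yang–Baxter equation if and only if either r = e₀∧u + c₁t₁ + c₂t₂ for some u ∈ 𝔤_λ and c₁, c₂ ∈ ℝ, or r = e₀∧u + a E₁₂ + ǎ Ě₁₂ + b F₁₂ + b̌ F̌₁₂ + c(t₁ − t₂) for some u ∈ S and a, ǎ, b, b̌, c ∈ ℝ; (2) a bivector r ∈ ⋀²𝔤_λ is a solution of the classical Yang–Baxter equation if and only if either r = e₀∧u for some u ∈ 𝔤_λ, or r = e₀∧u + a E₁₂ + ǎ Ě₁₂ + b F₁₂ + b̌ F̌₁₂ + c(t₁ − t₂) for some u ∈ S and a, ǎ, b, b̌, c ∈ ℝ with c² = a² + ǎ² − b² − b̌². -/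

import Mathlib

open Module LinearMap

noncomputable section

/-- Index type for the basis of an oscillator Lie algebra:
`Sum.inl 0 ↦ e₋₁`, `Sum.inl 1 ↦ e₀`, `Sum.inr (Sum.inl i) ↦ eᵢ`,
`Sum.inr (Sum.inr i) ↦ ěᵢ`. -/
abbrev OscIdx (n : ℕ) := Fin 2 ⊕ (Fin n ⊕ Fin n)

/-- The oscillator Lie algebra `𝔤_λ`: a real Lie algebra `L` together with a basis
`{e₋₁, e₀, e₁, …, eₙ, ě₁, …, ěₙ}` whose nonzero brackets on basis vectors are
`[e₋₁, eⱼ] = λⱼ ěⱼ`, `[e₋₁, ěⱼ] = −λⱼ eⱼ`, `[eⱼ, ěⱼ] = e₀` (all other brackets of the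
basis vectors vanish or follow by antisymmetry; in particular `e₀` is central). -/
structure OscAlg (n : ℕ) (lam : Fin n → ℝ) (L : Type) [LieRing L] [LieAlgebra ℝ L] where
  basis : Basis (OscIdx n) ℝ L
  bracket_em_e : ∀ j, ⁅basis (Sum.inl 0), basis (Sum.inr (Sum.inl j))⁆
      = lam j • basis (Sum.inr (Sum.inr j))
  bracket_em_f : ∀ j, ⁅basis (Sum.inl 0), basis (Sum.inr (Sum.inr j))⁆
      = -lam j • basis (Sum.inr (Sum.inl j))
  bracket_e_f : ∀ i j, ⁅basis (Sum.inr (Sum.inl i)), basis (Sum.inr (Sum.inr j))⁆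
      = if i = j then basis (Sum.inl 1) else 0
  bracket_e_e : ∀ i j, ⁅basis (Sum.inr (Sum.inl i)), basis (Sum.inr (Sum.inl j))⁆ = 0
  bracket_f_f : ∀ i j, ⁅basis (Sum.inr (Sum.inr i)), basis (Sum.inr (Sum.inr j))⁆ = 0
  bracket_e0 : ∀ x : L, ⁅basis (Sum.inl 1), x⁆ = 0

/-- `0 < λ₁ ≤ … ≤ λₙ`: the standing assumption on the parameters of an oscillator
Lie algebra. -/
def OscParam {n : ℕ} (lam : Fin n → ℝ) : Prop := (∀ i, 0 < lam i) ∧ Monotone lam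

/-- Genericity: `0 < λ₁ < … < λₙ` and `λ_k ≠ λ_i + λ_j` for all `i < j < k`. -/
def IsGeneric {n : ℕ} (lam : Fin n → ℝ) : Prop :=
  (∀ i, 0 < lam i) ∧ StrictMono lam ∧
    ∀ i j k : Fin n, i < j → j < k → lam k ≠ lam i + lam j

namespace OscAlg

variable {n : ℕ} {lam : Fin n → ℝ} {L : Type} [LieRing L] [LieAlgebra ℝ L]

/-- `e₋₁`. -/
def em (B : OscAlg n lam L) : L := B.basis (Sum.inl 0)
/-- `e₀`. -/
def e0 (B : OscAlg n lam L) : L := B.basis (Sum.inl 1)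
/-- `eᵢ`. -/
def e (B : OscAlg n lam L) (i : Fin n) : L := B.basis (Sum.inr (Sum.inl i))
/-- `ěᵢ`. -/
def f (B : OscAlg n lam L) (i : Fin n) : L := B.basis (Sum.inr (Sum.inr i))
/-- `e₋₁*`, an element of the dual basis. -/
def em' (B : OscAlg n lam L) : Dual ℝ L := B.basis.coord (Sum.inl 0)
/-- `e₀*`. -/
def e0' (B : OscAlg n lam L) : Dual ℝ L := B.basis.coord (Sum.inl 1)
/-- `eᵢ*`. -/
def e' (B : OscAlg n lam L) (i : Fin n) : Dual ℝ L := B.basis.coord (Sum.inr (Sum.inl i))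
/-- `ěᵢ*`. -/
def f' (B : OscAlg n lam L) (i : Fin n) : Dual ℝ L := B.basis.coord (Sum.inr (Sum.inr i))

/-- The subspace `S` spanned by the `eᵢ, ěᵢ`. -/
def S (B : OscAlg n lam L) : Submodule ℝ L :=
  Submodule.span ℝ (Set.range B.e ∪ Set.range B.f)

/-- The `2`-form `ω` on `𝔤_λ`, viewed as a linear map `𝔤_λ → 𝔤_λ*`:
`ω(e₋₁,·) = ω(e₀,·) = 0`, `ω(eᵢ,eⱼ) = ω(ěᵢ,ěⱼ) = 0`, `ω(eᵢ,ěⱼ) = δᵢⱼ`. -/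
def om (B : OscAlg n lam L) : L →ₗ[ℝ] Dual ℝ L :=
  ∑ i : Fin n, ((B.e' i).smulRight (B.f' i) - (B.f' i).smulRight (B.e' i))

/-- The derivation `J_a` of `𝔤_λ` given by `J_a(e₋₁) = J_a(e₀) = 0`, `J_a(eᵢ) = aᵢ ěᵢ`,
`J_a(ěᵢ) = −aᵢ eᵢ`. -/
def Ja (B : OscAlg n lam L) (a : Fin n → ℝ) : L →ₗ[ℝ] L :=
  B.basis.constr ℝ (Sum.elim (fun _ => (0 : L))
    (Sum.elim (fun i => a i • B.f i) (fun i => -(a i) • B.e i)))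

end OscAlg

section Bivectors

variable {L : Type} [LieRing L] [LieAlgebra ℝ L]

/-- `x ∧ y`, viewed as the linear map `𝔤* → 𝔤`, `α ↦ α(x) y − α(y) x`; this corresponds
to the skew-symmetric bilinear form `(α,β) ↦ α(x)β(y) − α(y)β(x)` on `𝔤*`. -/
def wedge (x y : L) : Dual ℝ L →ₗ[ℝ] L :=
  (Module.Dual.eval ℝ L x).smulRight y - (Module.Dual.eval ℝ L y).smulRight x

/-- A bivector `r ∈ ⋀²𝔤`, identified with the linear map `r_# : 𝔤* → 𝔤` of the
corresponding skew-symmetric bilinear form on `𝔤*` (so `r(α,β) = β(r_#(α))`). -/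
def IsBivector (r : Dual ℝ L →ₗ[ℝ] L) : Prop := ∀ α β : Dual ℝ L, α (r β) = - β (r α)

/-- The coadjoint action `ad*_u α := α ∘ ad_u`. -/
def coad (u : L) : Dual ℝ L →ₗ[ℝ] Dual ℝ L := (LieAlgebra.ad ℝ L u).dualMap

/-- `J† r` for an endomorphism `J` of `𝔤`; in terms of bilinear forms,
`(J† r)(α,β) = r(α∘J, β) + r(α, β∘J)`. -/
def dag (J : L →ₗ[ℝ] L) (r : Dual ℝ L →ₗ[ℝ] L) : Dual ℝ L →ₗ[ℝ] L :=
  r ∘ₗ J.dualMap + J ∘ₗ r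

/-- The adjoint action `ad_u† r` of `u ∈ 𝔤` on bivectors:
`(ad_u† r)(α,β) = r(ad*_u α, β) + r(α, ad*_u β)`. -/
def adDag (u : L) (r : Dual ℝ L →ₗ[ℝ] L) : Dual ℝ L →ₗ[ℝ] L :=
  dag (LieAlgebra.ad ℝ L u) r

/-- The Schouten bracket `[r,r]` of a bivector with itself:
`[r,r](α,β,γ) = 2α([r_#β, r_#γ]) + 2β([r_#γ, r_#α]) + 2γ([r_#α, r_#β])`. -/
def schouten (r : Dual ℝ L →ₗ[ℝ] L) (α β γ : Dual ℝ L) : ℝ :=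
  2 * α ⁅r β, r γ⁆ + 2 * β ⁅r γ, r α⁆ + 2 * γ ⁅r α, r β⁆

/-- `r` is a solution of the classical Yang–Baxter equation: `[r,r] = 0`. -/
def IsCYBE (r : Dual ℝ L →ₗ[ℝ] L) : Prop := ∀ α β γ : Dual ℝ L, schouten r α β γ = 0

/-- `r` is a solution of the generalized classical Yang–Baxter equation:
`ad_u [r,r] = 0` for all `u`. -/
def IsGCYBE (r : Dual ℝ L →ₗ[ℝ] L) : Prop :=
  ∀ (u : L) (α β γ : Dual ℝ L),
    schouten r (coad u α) β γ + schouten r α (coad u β) γ + schouten r α β (coad u γ) = 0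

/-- A derivation of the Lie algebra `L`. -/
def IsDerivation (J : L →ₗ[ℝ] L) : Prop := ∀ x y : L, J ⁅x, y⁆ = ⁅J x, y⁆ + ⁅x, J y⁆

/-- The 1-cocycle condition for `ξ : 𝔤 → ⋀²𝔤` with respect to the adjoint action:
`ξ([u,v]) = ad_u† ξ(v) − ad_v† ξ(u)`. -/
def IsCocycle (ξ : L →ₗ[ℝ] (Dual ℝ L →ₗ[ℝ] L)) : Prop :=
  ∀ u v : L, ξ ⁅u, v⁆ = adDag u (ξ v) - adDag v (ξ u)

/-- The dual bracket `[α,β]*` associated to `ξ : 𝔤 → ⋀²𝔤`: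
`[α,β]*(u) = ξ(u)(α,β)`. -/
def dualBr (ξ : L →ₗ[ℝ] (Dual ℝ L →ₗ[ℝ] L)) (α β : Dual ℝ L) : Dual ℝ L :=
  (β : L →ₗ[ℝ] ℝ) ∘ₗ (ξ.flip α)

/-- `ξ : 𝔤 → ⋀²𝔤` is a Lie bialgebra structure: `ξ` takes values in bivectors, is a
1-cocycle, and the dual bracket satisfies the Jacobi identity. -/
def IsBialgebra (ξ : L →ₗ[ℝ] (Dual ℝ L →ₗ[ℝ] L)) : Prop :=
  (∀ (u : L) (α β : Dual ℝ L), α (ξ u β) = - β (ξ u α)) ∧ IsCocycle ξ ∧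
  ∀ α β γ : Dual ℝ L,
    dualBr ξ (dualBr ξ α β) γ + dualBr ξ (dualBr ξ β γ) α + dualBr ξ (dualBr ξ γ α) β = 0

end Bivectors

namespace OscAlg

variable {n : ℕ} {lam : Fin n → ℝ} {L : Type} [LieRing L] [LieAlgebra ℝ L]

/-- Membership in `⋀²S`: a bivector `r` with `r_#(e₋₁*) = r_#(e₀*) = 0` and
`Im r_# ⊆ S`. -/
def InW2S (B : OscAlg n lam L) (r : Dual ℝ L →ₗ[ℝ] L) : Prop :=
  IsBivector r ∧ r B.em' = 0 ∧ r B.e0' = 0 ∧ ∀ α : Dual ℝ L, r α ∈ B.S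

/-- `ω_{r₁,r₂}(α,β) = (1/2)(ω(r₁_#(α), r₂_#(β)) + ω(r₂_#(α), r₁_#(β)))`. -/
def omPair (B : OscAlg n lam L) (r₁ r₂ : Dual ℝ L →ₗ[ℝ] L) (α β : Dual ℝ L) : ℝ :=
  (1/2) * (B.om (r₁ α) (r₂ β) + B.om (r₂ α) (r₁ β))

end OscAlg

namespace OscAlg

variable {lam : Fin 2 → ℝ} {L : Type} [LieRing L] [LieAlgebra ℝ L]

/-- `tᵢ = eᵢ ∧ ěᵢ`. -/
def tI (B : OscAlg 2 lam L) (i : Fin 2) : Dual ℝ L →ₗ[ℝ] L := wedge (B.e i) (B.f i)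

/-- `E₁₂ = e₁∧ě₂ + ě₁∧e₂`. -/
def E12 (B : OscAlg 2 lam L) : Dual ℝ L →ₗ[ℝ] L :=
  wedge (B.e 0) (B.f 1) + wedge (B.f 0) (B.e 1)

/-- `Ě₁₂ = −e₁∧e₂ + ě₁∧ě₂`. -/
def E12c (B : OscAlg 2 lam L) : Dual ℝ L →ₗ[ℝ] L :=
  -wedge (B.e 0) (B.e 1) + wedge (B.f 0) (B.f 1)

/-- `F₁₂ = −e₁∧ě₂ + ě₁∧e₂`. -/
def F12 (B : OscAlg 2 lam L) : Dual ℝ L →ₗ[ℝ] L :=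
  -wedge (B.e 0) (B.f 1) + wedge (B.f 0) (B.e 1)

/-- `F̌₁₂ = e₁∧e₂ + ě₁∧ě₂`. -/
def F12c (B : OscAlg 2 lam L) : Dual ℝ L →ₗ[ℝ] L :=
  wedge (B.e 0) (B.e 1) + wedge (B.f 0) (B.f 1)

end OscAlg

namespace OscAlg

variable {lam : Fin 2 → ℝ} {L : Type} [LieRing L] [LieAlgebra ℝ L] (B : OscAlg 2 lam L)

theorem sum_coord_smul (x : L) :
    x = B.em' x • B.em + B.e0' x • B.e0 + B.e' 0 x • B.e 0 + B.e' 1 x • B.e 1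
      + B.f' 0 x • B.f 0 + B.f' 1 x • B.f 1 := by
  conv_lhs => rw [← B.basis.sum_repr x]
  simp only [Fintype.sum_sum_type, Fin.sum_univ_two, em, e0, e, f, em', e0', e', f',
    Basis.coord_apply]
  abel

theorem dual_apply (α : Dual ℝ L) (x : L) :
    α x = B.em' x * α B.em + B.e0' x * α B.e0 + B.e' 0 x * α (B.e 0) + B.e' 1 x * α (B.e 1)
      + B.f' 0 x * α (B.f 0) + B.f' 1 x * α (B.f 1) := by
  conv_lhs => rw [B.sum_coord_smul x]
  simp only [map_add, map_smul, smul_eq_mul]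

theorem lie_em_e (j : Fin 2) : ⁅B.em, B.e j⁆ = lam j • B.f j := B.bracket_em_e j

theorem lie_em_f (j : Fin 2) : ⁅B.em, B.f j⁆ = -lam j • B.e j := B.bracket_em_f j

theorem lie_e_em (j : Fin 2) : ⁅B.e j, B.em⁆ = -lam j • B.f j := by
  rw [← lie_skew, lie_em_e, neg_smul]

theorem lie_f_em (j : Fin 2) : ⁅B.f j, B.em⁆ = lam j • B.e j := by
  rw [← lie_skew, lie_em_f, neg_smul, neg_neg]

theorem lie_e_f (i j : Fin 2) : ⁅B.e i, B.f j⁆ = if i = j then B.e0 else 0 :=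
  B.bracket_e_f i j

theorem lie_f_e (i j : Fin 2) : ⁅B.f i, B.e j⁆ = if i = j then -B.e0 else 0 := by
  rw [← lie_skew, lie_e_f]
  split_ifs <;> simp_all

theorem lie_e_e (i j : Fin 2) : ⁅B.e i, B.e j⁆ = 0 := B.bracket_e_e i j

theorem lie_f_f (i j : Fin 2) : ⁅B.f i, B.f j⁆ = 0 := B.bracket_f_f i j

theorem lie_e0 (x : L) : ⁅B.e0, x⁆ = 0 := B.bracket_e0 x

theorem lie_e0_right (x : L) : ⁅x, B.e0⁆ = 0 := by
  rw [← lie_skew, lie_e0, neg_zero]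

/-- The Lie bracket of `𝔤_λ` in coordinates, tested against a linear form. -/
theorem dual_apply_lie (α : Dual ℝ L) (x y : L) :
    α ⁅x, y⁆ =
      (B.e' 0 x * B.f' 0 y - B.f' 0 x * B.e' 0 y + B.e' 1 x * B.f' 1 y - B.f' 1 x * B.e' 1 y)
          * α B.e0
        + lam 0 * (B.em' x * B.e' 0 y - B.e' 0 x * B.em' y) * α (B.f 0)
        + lam 1 * (B.em' x * B.e' 1 y - B.e' 1 x * B.em' y) * α (B.f 1)
        - lam 0 * (B.em' x * B.f' 0 y - B.f' 0 x * B.em' y) * α (B.e 0)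
        - lam 1 * (B.em' x * B.f' 1 y - B.f' 1 x * B.em' y) * α (B.e 1) := by
  conv_lhs => rw [B.sum_coord_smul x, B.sum_coord_smul y]
  simp only [add_lie, lie_add, smul_lie, lie_smul, lie_self, lie_em_e, lie_em_f, lie_e_em,
    lie_f_em, lie_e_f, lie_f_e, lie_e_e, lie_f_f, lie_e0, lie_e0_right, map_add, map_smul,
    map_neg, map_zero, smul_eq_mul, if_true, zero_ne_one, one_ne_zero, if_false]
  ring

theorem coord_basis :
    (B.em' B.em = 1 ∧ B.em' B.e0 = 0 ∧ (∀ i, B.em' (B.e i) = 0) ∧ ∀ i, B.em' (B.f i) = 0) ∧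
    (B.e0' B.em = 0 ∧ B.e0' B.e0 = 1 ∧ (∀ i, B.e0' (B.e i) = 0) ∧ ∀ i, B.e0' (B.f i) = 0) ∧
    ((∀ i, B.e' i B.em = 0) ∧ (∀ i, B.e' i B.e0 = 0) ∧
      (∀ i j, B.e' i (B.e j) = if i = j then 1 else 0) ∧ ∀ i j, B.e' i (B.f j) = 0) ∧
    ((∀ i, B.f' i B.em = 0) ∧ (∀ i, B.f' i B.e0 = 0) ∧
      (∀ i j, B.f' i (B.e j) = 0) ∧ ∀ i j, B.f' i (B.f j) = if i = j then 1 else 0) := by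
  simp [em, e0, e, f, em', e0', e', f', Finsupp.single_apply, eq_comm]

theorem mem_S_iff (x : L) : x ∈ B.S ↔ B.em' x = 0 ∧ B.e0' x = 0 := by
  constructor
  · intro hx
    suffices B.S ≤ LinearMap.ker B.em' ⊓ LinearMap.ker B.e0' from this hx
    rw [S, Submodule.span_le]
    rintro _ (⟨i, rfl⟩ | ⟨i, rfl⟩) <;> simp [B.coord_basis]
  · rintro ⟨h₁, h₂⟩
    rw [B.sum_coord_smul x, h₁, h₂]
    have he (i : Fin 2) : B.e i ∈ B.S := Submodule.subset_span (Or.inl ⟨i, rfl⟩)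
    have hf (i : Fin 2) : B.f i ∈ B.S := Submodule.subset_span (Or.inr ⟨i, rfl⟩)
    simp only [zero_smul, zero_add]
    exact add_mem (add_mem (add_mem (B.S.smul_mem _ (he 0)) (B.S.smul_mem _ (he 1)))
      (B.S.smul_mem _ (hf 0))) (B.S.smul_mem _ (hf 1))

end OscAlg

section Bivectors

variable {L : Type} [LieRing L] [LieAlgebra ℝ L]

theorem wedge_apply (x y : L) (α : Dual ℝ L) : wedge x y α = α x • y - α y • x := rfl

theorem coad_apply (u : L) (α : Dual ℝ L) (x : L) : coad u α x = α ⁅u, x⁆ := rfl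

theorem IsBivector.apply_self {r : Dual ℝ L →ₗ[ℝ] L} (hr : IsBivector r) (α : Dual ℝ L) :
    α (r α) = 0 := by
  linarith [hr α α]

end Bivectors

namespace OscAlg

variable {lam : Fin 2 → ℝ} {L : Type} [LieRing L] [LieAlgebra ℝ L] (B : OscAlg 2 lam L)

/-- A bivector without `e₋₁ ∧ S` component, expanded in the wedges of basis vectors. -/
theorem eq_wedge_add_of_isBivector {r : Dual ℝ L →ₗ[ℝ] L} (hr : IsBivector r)
    (he : ∀ i, B.e' i (r B.em') = 0) (hf : ∀ i, B.f' i (r B.em') = 0) :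
    r = wedge B.e0 (r B.e0') + B.f' 0 (r (B.e' 0)) • B.tI 0 + B.f' 1 (r (B.e' 1)) • B.tI 1
      + B.e' 1 (r (B.e' 0)) • wedge (B.e 0) (B.e 1)
      + B.f' 1 (r (B.e' 0)) • wedge (B.e 0) (B.f 1)
      + B.f' 0 (r (B.e' 1)) • wedge (B.e 1) (B.f 0)
      + B.f' 1 (r (B.f' 0)) • wedge (B.f 0) (B.f 1) := by
  have key (α : Dual ℝ L) : r α = α B.em • r B.em' + α B.e0 • r B.e0' + α (B.e 0) • r (B.e' 0)
      + α (B.e 1) • r (B.e' 1) + α (B.f 0) • r (B.f' 0) + α (B.f 1) • r (B.f' 1) := by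
    simp only [← map_smul, ← map_add]
    congr 1
    ext x
    rw [B.dual_apply α x]
    simp only [LinearMap.add_apply, LinearMap.smul_apply, smul_eq_mul]
    ring
  have h0 := hr.apply_self B.e0'
  have h1 := hr.apply_self B.em'
  have h2 := hr.apply_self (B.e' 0)
  have h3 := hr.apply_self (B.e' 1)
  have h4 := hr.apply_self (B.f' 0)
  have h5 := hr.apply_self (B.f' 1)
  ext α
  refine B.basis.ext_elem fun i => ?_
  simp only [← Basis.coord_apply]
  generalize B.basis.coord i = β
  rw [key α]
  simp only [LinearMap.add_apply, LinearMap.smul_apply, wedge_apply, tI, map_add, map_sub,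
    map_smul, smul_eq_mul, B.dual_apply β (r _), B.dual_apply α (r _)]
  rw [h0, h1, h2, h3, h4, h5, hr B.em' B.e0', hr B.em' (B.e' 0),
    hr B.em' (B.e' 1), hr B.em' (B.f' 0), hr B.em' (B.f' 1), he 0, he 1, hf 0, hf 1,
    hr (B.e' 0) B.e0', hr (B.e' 1) B.e0', hr (B.f' 0) B.e0', hr (B.f' 1) B.e0',
    hr (B.e' 0) (B.e' 1), hr (B.e' 0) (B.f' 0), hr (B.e' 0) (B.f' 1), hr (B.e' 1) (B.f' 0),
    hr (B.e' 1) (B.f' 1), hr (B.f' 0) (B.f' 1)]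
  ring

end OscAlg

namespace OscAlg

variable {lam : Fin 2 → ℝ} {L : Type} [LieRing L] [LieAlgebra ℝ L] (B : OscAlg 2 lam L)

theorem coad_em_e0' : coad B.em B.e0' = 0 := by
  ext x
  simp [coad_apply, B.dual_apply_lie, B.coord_basis]

theorem coad_em_e' (j : Fin 2) : coad B.em (B.e' j) = -lam j • B.f' j := by
  ext x
  fin_cases j <;> simp [coad_apply, B.dual_apply_lie, B.coord_basis]

theorem coad_em_f' (j : Fin 2) : coad B.em (B.f' j) = lam j • B.e' j := by
  ext x
  fin_cases j <;> simp [coad_apply, B.dual_apply_lie, B.coord_basis]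

theorem coad_e_em' (j : Fin 2) : coad (B.e j) B.em' = 0 := by
  ext x
  simp [coad_apply, B.dual_apply_lie, B.coord_basis]

theorem coad_e_e0' (j : Fin 2) : coad (B.e j) B.e0' = B.f' j := by
  ext x
  fin_cases j <;> simp [coad_apply, B.dual_apply_lie, B.coord_basis]

theorem coad_e_e' (i j : Fin 2) : coad (B.e i) (B.e' j) = 0 := by
  ext x
  fin_cases i <;> simp [coad_apply, B.dual_apply_lie, B.coord_basis]

theorem schouten_em_f_e {r : Dual ℝ L →ₗ[ℝ] L} (hr : IsBivector r) (j : Fin 2) :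
    schouten r B.em' (B.f' j) (B.e' j)
      = -2 * lam j * (B.e' j (r B.em') ^ 2 + B.f' j (r B.em') ^ 2) := by
  fin_cases j <;>
    simp [schouten, B.dual_apply_lie, B.coord_basis, hr B.em' (B.e' _), hr B.em' (B.f' _),
      hr.apply_self] <;> ring

/-- If `[r,r](e₋₁*, ěⱼ*, eⱼ*) = 0` for all `j` then `r` has no `e₋₁ ∧ S` component. -/
theorem coord_apply_em_eq_zero (hlam : 0 < lam 0 ∧ lam 0 < lam 1) {r : Dual ℝ L →ₗ[ℝ] L}
    (hr : IsBivector r) (h : ∀ j, schouten r B.em' (B.f' j) (B.e' j) = 0) (j : Fin 2) :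
    B.e' j (r B.em') = 0 ∧ B.f' j (r B.em') = 0 := by
  have hj : 0 < lam j := by
    fin_cases j
    · exact hlam.1
    · exact hlam.1.trans hlam.2
  have hsq : B.e' j (r B.em') ^ 2 + B.f' j (r B.em') ^ 2 = 0 := by
    have := h j
    rw [B.schouten_em_f_e hr, mul_eq_zero] at this
    exact this.resolve_left (by linarith)
  constructor <;> nlinarith [sq_nonneg (B.e' j (r B.em')), sq_nonneg (B.f' j (r B.em'))]

/-- The components of `[r,r]` along `e₀ ∧ ⋀²S`, for `r` without `e₋₁ ∧ S` component. -/
theorem schouten_e0' {r : Dual ℝ L →ₗ[ℝ] L} (hr : IsBivector r)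
    (h : ∀ j, B.e' j (r B.em') = 0 ∧ B.f' j (r B.em') = 0) {k pq px py qx qy xy : ℝ}
    (hk : B.e0' (r B.em') = k) (hpq : B.e' 1 (r (B.e' 0)) = pq) (hpx : B.f' 0 (r (B.e' 0)) = px)
    (hpy : B.f' 1 (r (B.e' 0)) = py) (hqx : B.f' 0 (r (B.e' 1)) = qx)
    (hqy : B.f' 1 (r (B.e' 1)) = qy) (hxy : B.f' 1 (r (B.f' 0)) = xy) :
    schouten r B.e0' (B.e' 0) (B.e' 1)
        = 2 * (k * (lam 1 * py - lam 0 * qx) + pq * (px + qy)) ∧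
    schouten r B.e0' (B.e' 0) (B.f' 1)
        = 2 * (k * (lam 0 * xy - lam 1 * pq) + py * (px + qy)) ∧
    schouten r B.e0' (B.e' 1) (B.f' 0)
        = 2 * (k * (lam 0 * pq - lam 1 * xy) + qx * (px + qy)) ∧
    schouten r B.e0' (B.f' 0) (B.f' 1)
        = 2 * (k * (lam 1 * qx - lam 0 * py) + xy * (px + qy)) ∧
    schouten r B.e0' (B.e' 0) (B.f' 0) = 2 * (pq * xy + px ^ 2 + py * qx) ∧
    schouten r B.e0' (B.e' 1) (B.f' 1) = 2 * (pq * xy + py * qx + qy ^ 2) := by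
  subst hk hpq hpx hpy hqx hqy hxy
  refine ⟨?_, ?_, ?_, ?_, ?_, ?_⟩ <;>
  simp [schouten, B.dual_apply_lie, B.coord_basis, hr B.em' B.e0', hr B.em' (B.e' _),
    hr B.em' (B.f' _), hr.apply_self, h,
    hr (B.e' 0) (B.e' 1), hr (B.e' 0) (B.f' 0), hr (B.e' 0) (B.f' 1), hr (B.e' 1) (B.f' 0),
    hr (B.e' 1) (B.f' 1), hr (B.f' 0) (B.f' 1)] <;>
  ring

end OscAlg

theorem eq_zero_of_mul_eq_mul {a b x y : ℝ} (ha : 0 < a) (hab : a < b) (h₁ : a * x = b * y)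
    (h₂ : a * y = b * x) : x = 0 ∧ y = 0 := by
  have key : (b ^ 2 - a ^ 2) ≠ 0 := by nlinarith
  constructor <;> refine (mul_eq_zero.mp ?_).resolve_left key <;>
    first
    | linear_combination -a * h₁ - b * h₂
    | linear_combination -b * h₁ - a * h₂

theorem eq_zero_or_of_linear_system {a b k t pq py qx xy : ℝ} (ha : 0 < a) (hab : a < b)
    (h₁ : k * (b * py - a * qx) + pq * t = 0) (h₂ : k * (a * xy - b * pq) + py * t = 0)
    (h₃ : k * (a * pq - b * xy) + qx * t = 0) (h₄ : k * (b * qx - a * py) + xy * t = 0) :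
    (pq = 0 ∧ py = 0 ∧ qx = 0 ∧ xy = 0) ∨ (k = 0 ∧ t = 0) := by
  by_cases ht : t = 0
  · by_cases hk : k = 0
    · exact Or.inr ⟨hk, ht⟩
    · subst ht
      simp only [mul_zero, add_zero, mul_eq_zero, hk, false_or, sub_eq_zero] at h₁ h₂ h₃ h₄
      obtain ⟨h, h'⟩ := eq_zero_of_mul_eq_mul ha hab h₁.symm h₄.symm
      obtain ⟨g, g'⟩ := eq_zero_of_mul_eq_mul ha hab h₂ h₃
      exact Or.inl ⟨g', h', h, g⟩
  · have hsum : pq ^ 2 + py ^ 2 + qx ^ 2 + xy ^ 2 = 0 := by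
      refine (mul_eq_zero.mp ?_).resolve_left ht
      linear_combination pq * h₁ + py * h₂ + qx * h₃ + xy * h₄
    left
    refine ⟨?_, ?_, ?_, ?_⟩ <;>
      nlinarith [sq_nonneg pq, sq_nonneg py, sq_nonneg qx, sq_nonneg xy]

theorem IsCYBE.isGCYBE {L : Type} [LieRing L] [LieAlgebra ℝ L] {r : Dual ℝ L →ₗ[ℝ] L}
    (h : IsCYBE r) : IsGCYBE r := fun u α β γ => by
  rw [h, h, h, add_zero, add_zero]

theorem schouten_smul_left {L : Type} [LieRing L] [LieAlgebra ℝ L] (r : Dual ℝ L →ₗ[ℝ] L)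
    (c : ℝ) (α β γ : Dual ℝ L) : schouten r (c • α) β γ = c * schouten r α β γ := by
  simp [schouten]
  ring

theorem schouten_rotate {L : Type} [LieRing L] [LieAlgebra ℝ L] (r : Dual ℝ L →ₗ[ℝ] L)
    (α β γ : Dual ℝ L) : schouten r α β γ = schouten r β γ α := by
  simp only [schouten]
  ring

theorem schouten_swap {L : Type} [LieRing L] [LieAlgebra ℝ L] (r : Dual ℝ L →ₗ[ℝ] L)
    (α β γ : Dual ℝ L) : schouten r α β γ = -schouten r α γ β := by
  rw [schouten, schouten, ← lie_skew (r β), ← lie_skew (r γ) (r α), ← lie_skew (r α) (r β)]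
  simp only [map_neg]
  ring

theorem schouten_zero_left {L : Type} [LieRing L] [LieAlgebra ℝ L] (r : Dual ℝ L →ₗ[ℝ] L)
    (β γ : Dual ℝ L) : schouten r 0 β γ = 0 := by
  simp [schouten]

namespace OscAlg

variable {lam : Fin 2 → ℝ} {L : Type} [LieRing L] [LieAlgebra ℝ L] (B : OscAlg 2 lam L)

theorem coord_apply_em_eq_zero_of_isGCYBE (hlam : 0 < lam 0 ∧ lam 0 < lam 1)
    {r : Dual ℝ L →ₗ[ℝ] L} (hr : IsBivector r) (h : IsGCYBE r) (j : Fin 2) :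
    B.e' j (r B.em') = 0 ∧ B.f' j (r B.em') = 0 := by
  refine B.coord_apply_em_eq_zero hlam hr (fun j => ?_) j
  have := h (B.e j) B.em' B.e0' (B.e' j)
  rw [coad_e_em', coad_e_e0', coad_e_e', schouten_zero_left, ← schouten_rotate r 0,
    schouten_zero_left] at this
  simpa using this

/-- A solution of the generalized equation is `e₀ ∧ u + c₁t₁ + c₂t₂`, or it has no
`e₋₁` component and the `ω`-trace of its `⋀²S` component vanishes. -/
theorem coord_of_isGCYBE (hlam : 0 < lam 0 ∧ lam 0 < lam 1)
    {r : Dual ℝ L →ₗ[ℝ] L} (hr : IsBivector r) (h : IsGCYBE r) :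
    (B.e' 1 (r (B.e' 0)) = 0 ∧ B.f' 1 (r (B.e' 0)) = 0 ∧ B.f' 0 (r (B.e' 1)) = 0 ∧
      B.f' 1 (r (B.f' 0)) = 0) ∨
    (B.e0' (r B.em') = 0 ∧ B.f' 0 (r (B.e' 0)) + B.f' 1 (r (B.e' 1)) = 0) := by
  have inv (α β : Dual ℝ L) :
      schouten r B.e0' (coad B.em α) β = -schouten r B.e0' α (coad B.em β) := by
    have := h B.em B.e0' α β
    rw [coad_em_e0', schouten_zero_left] at this
    linarith
  have smul₂ (c : ℝ) (α β : Dual ℝ L) :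
      schouten r B.e0' (c • α) β = c * schouten r B.e0' α β := by
    rw [schouten_rotate, schouten_smul_left, ← schouten_rotate]
  have smul₃ (c : ℝ) (α β : Dual ℝ L) :
      schouten r B.e0' α (c • β) = c * schouten r B.e0' α β := by
    rw [← schouten_rotate, schouten_smul_left, schouten_rotate]
  have hee := inv (B.e' 0) (B.e' 1)
  have hef := inv (B.e' 0) (B.f' 1)
  have hfe := inv (B.f' 0) (B.e' 1)
  have hff := inv (B.f' 0) (B.f' 1)
  simp only [coad_em_e', coad_em_f', smul₂, smul₃, schouten_swap r B.e0' (B.f' 0) (B.e' 1)]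
    at hee hef hfe hff
  obtain ⟨h₁, h₂⟩ := eq_zero_of_mul_eq_mul hlam.1 hlam.2
    (x := schouten r B.e0' (B.e' 1) (B.f' 0)) (y := schouten r B.e0' (B.e' 0) (B.f' 1))
    (by linarith) (by linarith)
  obtain ⟨h₃, h₄⟩ := eq_zero_of_mul_eq_mul hlam.1 hlam.2
    (x := schouten r B.e0' (B.f' 0) (B.f' 1)) (y := schouten r B.e0' (B.e' 0) (B.e' 1))
    (by linarith) (by linarith)
  obtain ⟨g₁, g₂, g₃, g₄, -, -⟩ := B.schouten_e0' hr
    (B.coord_apply_em_eq_zero_of_isGCYBE hlam hr h) rfl rfl rfl rfl rfl rfl rfl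
  exact eq_zero_or_of_linear_system hlam.1 hlam.2 (by linarith) (by linarith) (by linarith)
    (by linarith)

theorem eq_wedge_add_tI {r : Dual ℝ L →ₗ[ℝ] L} (hr : IsBivector r)
    (hm : ∀ j, B.e' j (r B.em') = 0 ∧ B.f' j (r B.em') = 0)
    (h : B.e' 1 (r (B.e' 0)) = 0 ∧ B.f' 1 (r (B.e' 0)) = 0 ∧ B.f' 0 (r (B.e' 1)) = 0 ∧
      B.f' 1 (r (B.f' 0)) = 0) :
    r = wedge B.e0 (r B.e0') + B.f' 0 (r (B.e' 0)) • B.tI 0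
      + B.f' 1 (r (B.e' 1)) • B.tI 1 := by
  conv_lhs => rw [B.eq_wedge_add_of_isBivector hr (fun i => (hm i).1) fun i => (hm i).2]
  simp only [h, zero_smul, add_zero]

theorem eq_wedge_add_traceless {r : Dual ℝ L →ₗ[ℝ] L} (hr : IsBivector r)
    (hm : ∀ j, B.e' j (r B.em') = 0 ∧ B.f' j (r B.em') = 0)
    (h : B.f' 0 (r (B.e' 0)) + B.f' 1 (r (B.e' 1)) = 0) :
    r = wedge B.e0 (r B.e0')
      + ((B.f' 1 (r (B.e' 0)) - B.f' 0 (r (B.e' 1))) / 2) • B.E12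
      + ((B.f' 1 (r (B.f' 0)) - B.e' 1 (r (B.e' 0))) / 2) • B.E12c
      + (-(B.f' 1 (r (B.e' 0)) + B.f' 0 (r (B.e' 1))) / 2) • B.F12
      + ((B.f' 1 (r (B.f' 0)) + B.e' 1 (r (B.e' 0))) / 2) • B.F12c
      + B.f' 0 (r (B.e' 0)) • (B.tI 0 - B.tI 1) := by
  have hswap : wedge (B.e 1) (B.f 0) = -wedge (B.f 0) (B.e 1) := by
    ext α
    simp [wedge_apply]
  conv_lhs => rw [B.eq_wedge_add_of_isBivector hr (fun i => (hm i).1) fun i => (hm i).2]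
  rw [hswap, eq_neg_of_add_eq_zero_right h, E12, E12c, F12, F12c]
  module

theorem apply_e0_mem_S {r : Dual ℝ L →ₗ[ℝ] L} (hr : IsBivector r)
    (h : B.e0' (r B.em') = 0) : r B.e0' ∈ B.S :=
  (B.mem_S_iff _).2 ⟨by rw [hr, h, neg_zero], hr.apply_self _⟩

/-- The trivector `e₀ ∧ (d₁t₁ + d₂t₂)`, up to the factor of the Schouten bracket. -/
def e0WedgeTI (d₁ d₂ : ℝ) (α β γ : Dual ℝ L) : ℝ :=
  2 * (α B.e0 * γ (d₁ • B.tI 0 β + d₂ • B.tI 1 β) + β B.e0 * α (d₁ • B.tI 0 γ + d₂ • B.tI 1 γ)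
    + γ B.e0 * β (d₁ • B.tI 0 α + d₂ • B.tI 1 α))

theorem isGCYBE_of_schouten_eq {r : Dual ℝ L →ₗ[ℝ] L} (d₁ d₂ : ℝ)
    (h : schouten r = B.e0WedgeTI d₁ d₂) : IsGCYBE r := by
  intro u α β γ
  simp [h, e0WedgeTI, tI, wedge_apply, coad_apply, B.dual_apply_lie, B.coord_basis]
  ring

theorem schouten_wedge_add_tI (u : L) (c₁ c₂ : ℝ) :
    schouten (wedge B.e0 u + c₁ • B.tI 0 + c₂ • B.tI 1) = B.e0WedgeTI (c₁ ^ 2) (c₂ ^ 2) := by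
  ext α β γ
  simp [schouten, e0WedgeTI, tI, wedge_apply, B.dual_apply_lie, B.coord_basis]
  ring

set_option maxHeartbeats 1000000 in
theorem schouten_wedge_add_traceless {u : L} (hu : u ∈ B.S) (a ac b bc c : ℝ) :
    schouten (wedge B.e0 u + a • B.E12 + ac • B.E12c + b • B.F12 + bc • B.F12c
        + c • (B.tI 0 - B.tI 1))
      = B.e0WedgeTI (c ^ 2 - (a ^ 2 + ac ^ 2 - b ^ 2 - bc ^ 2))
          (c ^ 2 - (a ^ 2 + ac ^ 2 - b ^ 2 - bc ^ 2)) := by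
  obtain ⟨hu, -⟩ := (B.mem_S_iff u).1 hu
  ext α β γ
  simp [schouten, e0WedgeTI, E12, E12c, F12, F12c, tI, wedge_apply, B.dual_apply_lie,
    B.coord_basis, hu]
  ring

end OscAlg

/-- **Proposition (dimension 6, Yang–Baxter solutions).** On the 6-dimensional
oscillator Lie algebra `𝔤_λ` with `0 < λ₁ < λ₂`: (1) `r` solves the generalized
classical Yang–Baxter equation iff `r = e₀∧u + c₁t₁ + c₂t₂` (`u ∈ 𝔤_λ`) or
`r = e₀∧u + a E₁₂ + ǎ Ě₁₂ + b F₁₂ + b̌ F̌₁₂ + c(t₁ − t₂)` (`u ∈ S`);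
(2) `r` solves the classical Yang–Baxter equation iff `r = e₀∧u` or
`r = e₀∧u + a E₁₂ + ǎ Ě₁₂ + b F₁₂ + b̌ F̌₁₂ + c(t₁ − t₂)` with `u ∈ S` and
`c² = a² + ǎ² − b² − b̌²`. -/
theorem oscillator_dim6_yang_baxter_classification
    {lam : Fin 2 → ℝ} (hlam : 0 < lam 0 ∧ lam 0 < lam 1)
    {L : Type} [LieRing L] [LieAlgebra ℝ L] (B : OscAlg 2 lam L)
    (r : Dual ℝ L →ₗ[ℝ] L) (hr : IsBivector r) :
    (IsGCYBE r ↔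
      ((∃ (u : L) (c₁ c₂ : ℝ), r = wedge B.e0 u + c₁ • B.tI 0 + c₂ • B.tI 1) ∨
       (∃ (u : L) (a ac b bc c : ℝ), u ∈ B.S ∧
          r = wedge B.e0 u + a • B.E12 + ac • B.E12c + b • B.F12 + bc • B.F12c
            + c • (B.tI 0 - B.tI 1)))) ∧
    (IsCYBE r ↔
      ((∃ u : L, r = wedge B.e0 u) ∨
       (∃ (u : L) (a ac b bc c : ℝ), u ∈ B.S ∧
          c ^ 2 = a ^ 2 + ac ^ 2 - b ^ 2 - bc ^ 2 ∧
          r = wedge B.e0 u + a • B.E12 + ac • B.E12c + b • B.F12 + bc • B.F12c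
            + c • (B.tI 0 - B.tI 1)))) := by
  constructor
  · constructor
    · intro h
      have hm := B.coord_apply_em_eq_zero_of_isGCYBE hlam hr h
      rcases B.coord_of_isGCYBE hlam hr h with h0 | ⟨hk, ht⟩
      · exact Or.inl ⟨_, _, _, B.eq_wedge_add_tI hr hm h0⟩
      · exact Or.inr ⟨_, _, _, _, _, _, B.apply_e0_mem_S hr hk,
          B.eq_wedge_add_traceless hr hm ht⟩
    · rintro (⟨u, c₁, c₂, rfl⟩ | ⟨u, a, ac, b, bc, c, hu, rfl⟩)
      · exact B.isGCYBE_of_schouten_eq _ _ (B.schouten_wedge_add_tI u c₁ c₂)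
      · exact B.isGCYBE_of_schouten_eq _ _ (B.schouten_wedge_add_traceless hu a ac b bc c)
  · constructor
    · intro h
      have hm := B.coord_apply_em_eq_zero_of_isGCYBE hlam hr h.isGCYBE
      obtain ⟨-, -, -, -, g₁, g₂⟩ := B.schouten_e0' hr hm rfl rfl rfl rfl rfl rfl rfl
      rw [h] at g₁ g₂
      rcases B.coord_of_isGCYBE hlam hr h.isGCYBE with h0 | ⟨hk, ht⟩
      · have hr' := B.eq_wedge_add_tI hr hm h0
        obtain ⟨h₁, h₂, h₃, h₄⟩ := h0
        have hx : B.f' 0 (r (B.e' 0)) = 0 := by simpa [h₁, h₂] using g₁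
        have hy : B.f' 1 (r (B.e' 1)) = 0 := by simpa [h₁, h₂] using g₂
        rw [hx, hy, zero_smul, zero_smul, add_zero, add_zero] at hr'
        exact Or.inl ⟨_, hr'⟩
      · refine Or.inr ⟨_, _, _, _, _, _, B.apply_e0_mem_S hr hk, ?_,
          B.eq_wedge_add_traceless hr hm ht⟩
        linear_combination -g₁ / 2
    · rintro (⟨u, rfl⟩ | ⟨u, a, ac, b, bc, c, hu, hc, rfl⟩) α β γ
      · have := B.schouten_wedge_add_tI u 0 0
        simp only [zero_smul, add_zero] at this
        simp [this, OscAlg.e0WedgeTI]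
      · rw [B.schouten_wedge_add_traceless hu, hc]
        simp [OscAlg.e0WedgeTI]
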